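/- Let α be a finite set with n = |α|, δ < n a non-negative integer, and Γ1 : α → {0, 1, ..., n} a total mapping such that β(Γ1) is nonempty and |{x ∈ α : Γ1(x) = 0}| = Σ_{j ∈ β(Γ1)} (δ − |{x ∈ α : Γ1(x) = j}| + 1). Let y ∈ α with Γ1(y) = 0 and let k be a positive integer with k ∉ β(Γ1). Define Γ3 to agree with Γ1 everywhere except Γ3(y) = k. Then β(Γ3) is nonempty and |{x ∈ α : Γ3(x) = 0}| < Σ_{j ∈ β(Γ3)} (δ − |{x ∈ α : Γ3(x) = j}| + 1). -/

import Mathlib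

/-- The size of the part `j` of a mapping `Γ`, i.e. `|{x : Γ(x) = j}|`. -/
def fiberCard {α : Type*} [Fintype α] (Γ : α → ℕ) (j : ℕ) : ℕ :=
  (Finset.univ.filter (fun x => Γ x = j)).card

/-- `β(Γ) = {j ∈ {1,…,n} : 0 < |{x : Γ(x) = j}| ≤ δ}`. -/
def betaSet {α : Type*} [Fintype α] (n δ : ℕ) (Γ : α → ℕ) : Finset ℕ :=
  (Finset.Icc 1 n).filter (fun j => 0 < fiberCard Γ j ∧ fiberCard Γ j ≤ δ)

/-- Reassigning `y` to `k` does not affect the parts other than `Γ y` and `k`. -/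
theorem fiberCard_update_of_ne {α : Type*} [Fintype α] [DecidableEq α] (Γ : α → ℕ) (y : α)
    {k j : ℕ} (hjy : j ≠ Γ y) (hjk : j ≠ k) :
    fiberCard (Function.update Γ y k) j = fiberCard Γ j := by
  unfold fiberCard
  congr 1
  ext x
  by_cases hx : x = y
  · subst hx
    simp [hjy.symm, hjk.symm]
  · simp [hx]

/-- Reassigning `y` to a different part shrinks the part it came from. -/
theorem fiberCard_update_self_lt {α : Type*} [Fintype α] [DecidableEq α] (Γ : α → ℕ) (y : α)
    {k : ℕ} (hk : k ≠ Γ y) :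
    fiberCard (Function.update Γ y k) (Γ y) < fiberCard Γ (Γ y) := by
  unfold fiberCard
  apply Finset.card_lt_card
  rw [Finset.ssubset_iff_of_subset]
  · exact ⟨y, by simp, by simpa using hk⟩
  · intro x hx
    by_cases hxy : x = y
    · simp [hxy]
    · simpa [hxy] using hx

/-- If `β(Γ1)` is nonempty, `|{x : Γ1(x) = 0}| = Σ_{j ∈ β(Γ1)} (δ − |{x : Γ1(x) = j}| + 1)`,
and `Γ3` is obtained from `Γ1` by mapping an unassigned `y` to a positive `k ∉ β(Γ1)`,
then `β(Γ3)` is nonempty and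
`|{x : Γ3(x) = 0}| < Σ_{j ∈ β(Γ3)} (δ − |{x : Γ3(x) = j}| + 1)`. -/
theorem statement_6 (α : Type*) [Fintype α] [DecidableEq α]
    (n δ : ℕ) (hn : n = Fintype.card α) (hδ : δ < n)
    (Γ1 : α → ℕ) (hbound : ∀ x, Γ1 x ≤ n)
    (hne : (betaSet n δ Γ1).Nonempty)
    (heq : fiberCard Γ1 0 = ∑ j ∈ betaSet n δ Γ1, (δ - fiberCard Γ1 j + 1))
    (y : α) (hy : Γ1 y = 0)
    (k : ℕ) (hk : 0 < k) (hkβ : k ∉ betaSet n δ Γ1)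
    (Γ3 : α → ℕ) (hΓ3 : Γ3 = Function.update Γ1 y k) :
    (betaSet n δ Γ3).Nonempty ∧
      fiberCard Γ3 0 < ∑ j ∈ betaSet n δ Γ3, (δ - fiberCard Γ3 j + 1) := by
  subst hΓ3
  have hcard : ∀ j ∈ betaSet n δ Γ1, fiberCard (Function.update Γ1 y k) j = fiberCard Γ1 j := by
    intro j hj
    have hj1 : 1 ≤ j := (Finset.mem_Icc.mp (Finset.mem_filter.mp hj).1).1
    refine fiberCard_update_of_ne Γ1 y (by omega) ?_
    rintro rfl
    exact hkβ hj
  have hsub : betaSet n δ Γ1 ⊆ betaSet n δ (Function.update Γ1 y k) := by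
    intro j hj
    have hj' := Finset.mem_filter.mp hj
    refine Finset.mem_filter.mpr ⟨hj'.1, ?_⟩
    rw [hcard j hj]
    exact hj'.2
  refine ⟨hne.mono hsub, ?_⟩
  have hlt := fiberCard_update_self_lt Γ1 y (k := k) (by omega)
  rw [hy] at hlt
  calc fiberCard (Function.update Γ1 y k) 0 < fiberCard Γ1 0 := hlt
    _ = ∑ j ∈ betaSet n δ Γ1, (δ - fiberCard Γ1 j + 1) := heq
    _ = ∑ j ∈ betaSet n δ Γ1, (δ - fiberCard (Function.update Γ1 y k) j + 1) :=
      Finset.sum_congr rfl fun j hj => by rw [hcard j hj]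
    _ ≤ _ := Finset.sum_le_sum_of_subset hsub
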